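/- Let Σ be an N×N real symmetric positive definite matrix with smallest eigenvalue σ > 0, and let X = (X_1,…,X_N) be a centered Gaussian vector with covariance matrix Σ. Then P(X_k > 0 for all 1 ≤ k ≤ N) ≥ σ^{N/2} / (2^N √(det Σ)). -/

import Mathlib

open MeasureTheory ProbabilityTheory Matrix

noncomputable section

/-- Normalized Lebesgue measure `λ` on `T = [-π,π]`, with `λ(T) = 1`. -/
def normLeb1 : Measure ℝ :=
  (ENNReal.ofReal (2 * Real.pi))⁻¹ • (volume.restrict (Set.Icc (-Real.pi) Real.pi))

/-- Fourier coefficient `μ̂(m) = ∫_T e^{imt} dμ(t)` for `m ∈ ℤ`. -/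
def muHat1 (μ : Measure ℝ) (m : ℤ) : ℂ :=
  ∫ t, Complex.exp (Complex.I * (m : ℂ) * (t : ℂ)) ∂μ

/-- The matrix `Σ_N = (μ̂(j-k))_{1 ≤ j,k ≤ N}` (real, since `μ` is symmetric). -/
def SigmaN (μ : Measure ℝ) (N : ℕ) : Matrix (Fin N) (Fin N) ℝ :=
  fun j k => (muHat1 μ ((j.1 : ℤ) - (k.1 : ℤ))).re

/-- `X` is a centered Gaussian vector with covariance matrix `S` (under `P`):
every linear combination of the coordinates is a centered one-dimensional
Gaussian with the corresponding variance. -/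
def IsCenteredGaussianVec {ι : Type*} [Fintype ι] {Ω : Type*} [MeasurableSpace Ω]
    (P : Measure Ω) (X : ι → Ω → ℝ) (S : Matrix ι ι ℝ) : Prop :=
  ∀ u : ι → ℝ,
    P.map (fun ω => ∑ i, u i * X i ω) =
      gaussianReal 0 (Real.toNNReal (u ⬝ᵥ S.mulVec u))

open scoped MatrixOrder

/-- Density of the standard Gaussian product measure. -/
lemma pi_gaussian_withDensity (N : ℕ) :
    Measure.pi (fun _ : Fin N => gaussianReal 0 1) =
      (volume : Measure (Fin N → ℝ)).withDensity
        (fun x => ENNReal.ofReal (∏ i, gaussianPDFReal 0 1 (x i))) := by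
  refine Measure.pi_eq fun s hs => ?_
  rw [withDensity_apply _ (MeasurableSet.univ_pi hs), volume_pi, Measure.restrict_pi_pi,
    ← ofReal_integral_eq_lintegral_ofReal]
  · rw [integral_fintype_prod_eq_prod (f := fun _ x => gaussianPDFReal 0 1 x),
      ENNReal.ofReal_prod_of_nonneg]
    · refine Finset.prod_congr rfl fun i _ => ?_
      rw [gaussianReal_apply_eq_integral 0 one_ne_zero]
    · intro i _
      exact integral_nonneg fun x => gaussianPDFReal_nonneg 0 1 x
  · exact Integrable.fintype_prod (f := fun _ x => gaussianPDFReal 0 1 x)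
      fun i => (integrable_gaussianPDFReal 0 1).restrict
  · exact Filter.Eventually.of_forall fun x =>
      Finset.prod_nonneg fun i _ => gaussianPDFReal_nonneg 0 1 _

lemma prod_pdf_le {N : ℕ} (x y : Fin N → ℝ) (h : y ⬝ᵥ y ≤ x ⬝ᵥ x) :
    ∏ i, gaussianPDFReal 0 1 (x i) ≤ ∏ i, gaussianPDFReal 0 1 (y i) := by
  simp only [gaussianPDFReal, Finset.prod_mul_distrib, ← Real.exp_sum]
  refine mul_le_mul_of_nonneg_left (Real.exp_le_exp.2 ?_)
    (Finset.prod_nonneg fun i _ => by positivity)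
  simp only [← Finset.sum_div, Finset.sum_neg_distrib, sub_zero]
  simp only [dotProduct, ← pow_two] at h
  simp
  linarith

lemma gaussian_Ioi : gaussianReal 0 1 (Set.Ioi 0) = 2⁻¹ := by
  have h1 : gaussianReal 0 1 (Set.Iio 0) = gaussianReal 0 1 (Set.Ioi 0) := by
    have h := gaussianReal_map_neg (μ := 0) (v := 1)
    rw [neg_zero] at h
    conv_lhs => rw [← h]
    rw [Measure.map_apply (by fun_prop) measurableSet_Iio]
    congr 1
    ext x
    simp
  have : NullSingletonClass (gaussianReal 0 1) := nullSingletonClass_gaussianReal one_ne_zero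
  have h2 := prob_add_prob_compl (μ := gaussianReal 0 1) (measurableSet_Ioi (a := (0 : ℝ)))
  rw [Set.compl_Ioi, ← Iio_ae_eq_Iic.measure_eq, h1, ← two_mul] at h2
  exact (ENNReal.eq_inv_of_mul_eq_one_left (by rwa [mul_comm]))

lemma orthant_std (N : ℕ) :
    Measure.pi (fun _ : Fin N => gaussianReal 0 1) (Set.univ.pi fun _ => Set.Ioi 0) =
      (2 ^ N)⁻¹ := by
  rw [Measure.pi_pi]
  simp [gaussian_Ioi, ENNReal.inv_pow]

lemma image_lower {N : ℕ} (B : Matrix (Fin N) (Fin N) ℝ) (hdet : B.det ≠ 0)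
    (hB : ∀ w, (B *ᵥ w) ⬝ᵥ (B *ᵥ w) ≤ w ⬝ᵥ w) (O : Set (Fin N → ℝ)) (hO : MeasurableSet O) :
    ENNReal.ofReal |B.det| * Measure.pi (fun _ : Fin N => gaussianReal 0 1) O ≤
      Measure.pi (fun _ : Fin N => gaussianReal 0 1) ((fun w => B *ᵥ w) '' O) := by
  have hinj : Function.Injective (fun w => B *ᵥ w) :=
    Matrix.mulVec_injective_iff_isUnit.2 ((Matrix.isUnit_iff_isUnit_det B).2 hdet.isUnit)
  have hd : ∀ x ∈ O, HasFDerivWithinAt (fun w => B *ᵥ w)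
      (LinearMap.toContinuousLinearMap B.mulVecLin) O x := fun x _ =>
    (LinearMap.toContinuousLinearMap B.mulVecLin).hasFDerivWithinAt
  have hmeas : MeasurableSet ((fun w => B *ᵥ w) '' O) :=
    measurable_image_of_fderivWithin hO hd hinj.injOn
  have hdt : (LinearMap.toContinuousLinearMap B.mulVecLin).det = B.det := by
    rw [LinearMap.det_toContinuousLinearMap, ← Matrix.toLin'_apply', LinearMap.det_toLin']
  rw [pi_gaussian_withDensity, withDensity_apply _ hO, withDensity_apply _ hmeas,
    lintegral_image_eq_lintegral_abs_det_fderiv_mul volume hO hd hinj.injOn,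
    ← lintegral_const_mul' _ _ ENNReal.ofReal_ne_top]
  refine lintegral_mono fun w => ?_
  simp only [hdt]
  exact mul_le_mul_right (ENNReal.ofReal_le_ofReal (prod_pdf_le _ _ (hB w))) _

lemma law_eq {N : ℕ} (S : Matrix (Fin N) (Fin N) ℝ) (hS : S.PosDef)
    {Ω : Type} [MeasurableSpace Ω] (P : Measure Ω) [IsProbabilityMeasure P]
    (X : Fin N → Ω → ℝ) (hX : IsCenteredGaussianVec P X S) (hm : ∀ i, AEMeasurable (X i) P) :
    P.map (fun ω => WithLp.toLp 2 (fun i => X i ω)) = multivariateGaussian 0 S := by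
  have hm' : AEMeasurable (fun ω => WithLp.toLp 2 (fun i => X i ω)) P :=
    (MeasurableEquiv.toLp 2 (Fin N → ℝ)).measurable.comp_aemeasurable (aemeasurable_pi_lambda _ hm)
  have : IsProbabilityMeasure (P.map (fun ω => WithLp.toLp 2 (fun i => X i ω))) :=
    Measure.isProbabilityMeasure_map hm'
  apply Measure.ext_of_charFun
  ext t
  rw [charFun_multivariateGaussian hS.posSemidef, charFun_apply, integral_map hm' (by fun_prop)]
  have h := congrArg (fun μ => charFun μ 1) (hX t)
  simp only at h
  rw [charFun_gaussianReal, charFun_apply, integral_map (by fun_prop) (by fun_prop)] at h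
  have hnn : 0 ≤ t.ofLp ⬝ᵥ S *ᵥ t.ofLp := by
    simpa using hS.posSemidef.dotProduct_mulVec_nonneg t.ofLp
  simpa [PiLp.inner_apply, hnn] using h

lemma quad_lower {N : ℕ} (S : Matrix (Fin N) (Fin N) ℝ) (hS : S.PosDef) (σ : ℝ)
    (hmin : ∀ x : ℝ, Module.End.HasEigenvalue (Matrix.mulVecLin S) x → σ ≤ x)
    (x : Fin N → ℝ) : σ * (x ⬝ᵥ x) ≤ x ⬝ᵥ S *ᵥ x := by
  have h : (S - algebraMap ℝ _ σ).PosSemidef := by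
    rw [posSemidef_iff_isHermitian_and_spectrum_nonneg]
    constructor
    · refine hS.isHermitian.sub ?_
      rw [Algebra.algebraMap_eq_smul_one]
      simp [Matrix.IsHermitian]
    · rw [← spectrum.sub_singleton_eq]
      rintro _ ⟨a, ha, b, rfl, rfl⟩
      have := hmin a (by
        rw [Module.End.hasEigenvalue_iff_mem_spectrum, ← Matrix.toLin'_apply',
          Matrix.spectrum_toLin']
        exact ha)
      simpa using this
  have h2 := h.dotProduct_mulVec_nonneg x
  simp [Matrix.sub_mulVec, Algebra.algebraMap_eq_smul_one, Matrix.smul_mulVec] at h2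
  exact h2

/-- If `Σ` is positive definite with smallest eigenvalue `σ > 0`
and `X` is a centered Gaussian vector with covariance `Σ`, then
`P(X_k > 0 ∀k) ≥ σ^{N/2} / (2^N √(det Σ))`. -/
theorem gaussian_orthant_lower_bound
    (N : ℕ) (hN : 1 ≤ N) (S : Matrix (Fin N) (Fin N) ℝ) (hS : S.PosDef)
    (σ : ℝ) (hσ : 0 < σ)
    (heig : Module.End.HasEigenvalue (Matrix.mulVecLin S) σ)
    (hmin : ∀ x : ℝ, Module.End.HasEigenvalue (Matrix.mulVecLin S) x → σ ≤ x)
    (Ω : Type) [MeasurableSpace Ω] (P : Measure Ω) [IsProbabilityMeasure P]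
    (X : Fin N → Ω → ℝ) (hX : IsCenteredGaussianVec P X S) :
    ENNReal.ofReal (σ ^ ((N : ℝ) / 2) / (2 ^ N * Real.sqrt S.det)) ≤
      P {ω | ∀ k : Fin N, 0 < X k ω} := by
  have hm : ∀ i, AEMeasurable (X i) P := by
    intro i
    by_contra hcon
    have h := hX (Pi.single i 1)
    have he : (fun ω => ∑ j, (Pi.single i 1 : Fin N → ℝ) j * X j ω) = X i := by
      ext ω
      simp [Pi.single_apply]
    rw [he, Measure.map_of_not_aemeasurable hcon] at h
    exact (IsProbabilityMeasure.ne_zero (gaussianReal 0 _)) h.symm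
  have hlaw := law_eq S hS P X hX hm
  have hm' : AEMeasurable (fun ω => WithLp.toLp 2 (fun i => X i ω)) P :=
    (MeasurableEquiv.toLp 2 (Fin N → ℝ)).measurable.comp_aemeasurable (aemeasurable_pi_lambda _ hm)
  set R := CFC.sqrt S with hR
  have hRR : R * R = S := CFC.sqrt_mul_sqrt_self S hS.posSemidef.nonneg
  have hRT : Rᵀ = R := by
    have := (CFC.sqrt_nonneg S).posSemidef.isHermitian
    simpa [Matrix.IsHermitian, Matrix.conjTranspose_eq_transpose_of_trivial] using this
  have hSd : 0 < S.det := hS.det_pos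
  have hdd : R.det * R.det = S.det := by rw [← Matrix.det_mul, hRR]
  have hRd0 : R.det ≠ 0 := by
    intro h0
    rw [h0, mul_zero] at hdd
    exact hSd.ne hdd
  have hRdet : |R.det| = Real.sqrt S.det := by
    rw [← hdd, Real.sqrt_mul_self_eq_abs]
  have hRu : IsUnit R.det := hRd0.isUnit
  -- the contraction
  set B : Matrix (Fin N) (Fin N) ℝ := Real.sqrt σ • R⁻¹ with hBdef
  have hs : 0 < Real.sqrt σ := Real.sqrt_pos.2 hσ
  have hBdet : |B.det| = σ ^ ((N : ℝ) / 2) / Real.sqrt S.det := by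
    rw [hBdef, Matrix.det_smul, Fintype.card_fin, Matrix.det_nonsing_inv, Ring.inverse_eq_inv',
      abs_mul, abs_inv, hRdet, abs_of_pos (pow_pos hs N), div_eq_mul_inv]
    congr 1
    rw [Real.sqrt_eq_rpow, ← Real.rpow_natCast, ← Real.rpow_mul hσ.le]
    congr 1
    ring
  have hBd0 : B.det ≠ 0 := by
    rw [← abs_pos, hBdet]
    have := Real.sqrt_pos.2 hSd
    positivity
  have hRB : ∀ w, R *ᵥ (B *ᵥ w) = Real.sqrt σ • w := by
    intro w
    rw [Matrix.mulVec_mulVec, hBdef, Matrix.mul_smul, Matrix.mul_nonsing_inv R hRu,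
      Matrix.smul_mulVec, Matrix.one_mulVec]
  have hB : ∀ w, (B *ᵥ w) ⬝ᵥ (B *ᵥ w) ≤ w ⬝ᵥ w := by
    intro w
    have h := quad_lower S hS σ hmin (B *ᵥ w)
    rw [← hRR, ← Matrix.mulVec_mulVec, Matrix.dotProduct_mulVec (B *ᵥ w) R, ← Matrix.mulVec_transpose, hRT,
      hRB, smul_dotProduct, dotProduct_smul, smul_smul, Real.mul_self_sqrt hσ.le,
      smul_eq_mul] at h
    exact le_of_mul_le_mul_left h hσ
  have hO : MeasurableSet (Set.univ.pi fun _ : Fin N => Set.Ioi (0 : ℝ)) :=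
    MeasurableSet.univ_pi fun _ => measurableSet_Ioi
  have hmain := image_lower B hBd0 hB _ hO
  rw [orthant_std, hBdet] at hmain
  have hset : MeasurableSet {x : EuclideanSpace ℝ (Fin N) | ∀ k, 0 < x k} := by
    rw [Set.ofPred_forall]
    exact MeasurableSet.iInter fun k => measurableSet_lt measurable_const (by fun_prop)
  have hP : P {ω | ∀ k : Fin N, 0 < X k ω} =
      multivariateGaussian 0 S {x : EuclideanSpace ℝ (Fin N) | ∀ k, 0 < x k} := by
    rw [← hlaw, Measure.map_apply_of_aemeasurable hm' hset]
    rfl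
  rw [hP, multivariateGaussian, ← map_pi_eq_stdGaussian, Measure.map_map (by fun_prop)
    (by fun_prop), Measure.map_apply (by fun_prop) hset]
  calc _ = ENNReal.ofReal (σ ^ ((N : ℝ) / 2) / Real.sqrt S.det) * (2 ^ N)⁻¹ := by
        have : ((2 : ENNReal) ^ N)⁻¹ = ENNReal.ofReal ((2 ^ N)⁻¹) := by
          rw [ENNReal.ofReal_inv_of_pos (by positivity), ENNReal.ofReal_pow (by norm_num)]
          simp
        rw [this, ← ENNReal.ofReal_mul (by positivity)]
        congr 1
        field_simp
    _ ≤ _ := hmain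
    _ ≤ _ := by
        refine measure_mono ?_
        rintro _ ⟨w, hw, rfl⟩ k
        have hk := congrFun (hRB w) k
        have hwk : 0 < w k := hw k (Set.mem_univ k)
        simp only [Function.comp, zero_add, Matrix.ofLp_toEuclideanCLM]
        rw [← hR, hk]
        exact mul_pos hs hwk
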